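/- arXiv:2109.09024 — 2 statements merged into one kernel-verified Lean document; each statement's English description precedes it below -/
import Mathlib

section
/- Let p > 1 and a > 1, let f(v) = |v|^{p-1} v / (log(2 + v^2))^a, and let t₀ > 0. Suppose φ₀ : [-t₀, 0) → (0, ∞) is a C² function such that φ₀''(t) = φ₀(t)^p + f(φ₀(t)) on [-t₀, 0), φ₀'(t) ≥ 0 on [-t₀, 0), and (-t)^{2/(p-1)} · φ₀(t) → κ₀ as t → 0⁻. Define φ(s) = e^{-2s/(p-1)} · φ₀(-e^{-s}). Then there exist C > 0 and s₁ > 0 such that |φ'(s)| ≤ C / s^a for all s ≥ s₁. -/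
open Filter Set

/-- The strong perturbation `f(v) = |v|^{p-1} v / (log(2+v^2))^a`. -/
noncomputable def f (p a v : ℝ) : ℝ := |v| ^ (p - 1) * v / Real.log (2 + v ^ 2) ^ a

/-- The constant `κ₀ = (2(p+1)/(p-1)^2)^{1/(p-1)}`. -/
noncomputable def kappa0 (p : ℝ) : ℝ := (2 * (p + 1) / (p - 1) ^ 2) ^ (1 / (p - 1))

/-- The energy `u'^2/2 - u^(p+1)/(p+1)` of a nondecreasing solution of
`u'' = u^p + u^p / log(2+u^2)^a` is at most of order `u^(p+1) / log(2+u^2)^a`. -/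
lemma exists_abs_energy_le {p a t₁ : ℝ} (hp : 1 < p) (ha : 1 < a) {u u' : ℝ → ℝ}
    (ht₁ : t₁ < 0)
    (hd1 : ∀ t ∈ Ico t₁ 0, HasDerivAt u (u' t) t)
    (hd2 : ∀ t ∈ Ico t₁ 0,
      HasDerivAt u' (u t ^ p + u t ^ p / Real.log (2 + u t ^ 2) ^ a) t)
    (hpos : ∀ t ∈ Ico t₁ 0, 0 < u t) (hmono : ∀ t ∈ Ico t₁ 0, 0 ≤ u' t)
    (hL : ∀ t ∈ Ico t₁ 0, 2 * a ≤ Real.log (2 + u t ^ 2)) :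
    ∃ K : ℝ, 0 < K ∧ ∀ t ∈ Ico t₁ 0,
      |u' t ^ 2 / 2 - u t ^ (p + 1) / (p + 1)| ≤
        K * (u t ^ (p + 1) / Real.log (2 + u t ^ 2) ^ a) := by
  set e : ℝ → ℝ := fun t => u' t ^ 2 / 2 - u t ^ (p + 1) / (p + 1) with he
  set H : ℝ → ℝ := fun t => u t ^ (p + 1) / Real.log (2 + u t ^ 2) ^ a with hH
  have hLpos : ∀ t ∈ Ico t₁ 0, 0 < Real.log (2 + u t ^ 2) := fun t ht => by
    linarith [hL t ht]
  have hHpos : ∀ t ∈ Ico t₁ 0, 0 < H t := fun t ht =>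
    div_pos (Real.rpow_pos_of_pos (hpos t ht) _) (Real.rpow_pos_of_pos (hLpos t ht) _)
  have hde : ∀ t ∈ Ico t₁ 0,
      HasDerivAt e (u t ^ p / Real.log (2 + u t ^ 2) ^ a * u' t) t := fun t ht => by
    have h1 := ((hd2 t ht).pow 2).div_const 2
    have h2 := ((hd1 t ht).rpow_const (p := p + 1) (Or.inl (hpos t ht).ne')).div_const (p + 1)
    refine (h1.sub h2).congr_deriv ?_
    have : p + 1 ≠ 0 := by linarith
    rw [show p + 1 - 1 = p by ring]
    field_simp
    ring
  have hdH : ∀ t ∈ Ico t₁ 0,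
      HasDerivAt H (u t ^ p / Real.log (2 + u t ^ 2) ^ a * u' t *
        ((p + 1) - a * (2 * u t ^ 2 / ((2 + u t ^ 2) * Real.log (2 + u t ^ 2))))) t :=
    fun t ht => by
    have hu := hpos t ht
    have hl := hLpos t ht
    have h1 := (hd1 t ht).rpow_const (p := p + 1) (Or.inl hu.ne')
    have hq : 0 < 2 + u t ^ 2 := by positivity
    have h2 := ((((hd1 t ht).fun_pow 2).const_add 2).log hq.ne').rpow_const
      (p := a) (Or.inl hl.ne')
    refine (h1.div h2 (Real.rpow_pos_of_pos hl a).ne').congr_deriv ?_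
    have hla := Real.rpow_pos_of_pos hl a
    rw [show p + 1 - 1 = p by ring, Real.rpow_add_one hu.ne', Real.rpow_sub_one hl.ne']
    field_simp
    ring
  have hfac : ∀ t ∈ Ico t₁ 0,
      1 ≤ (p + 1) - a * (2 * u t ^ 2 / ((2 + u t ^ 2) * Real.log (2 + u t ^ 2))) :=
    fun t ht => by
    have hl := hLpos t ht
    have : a * (2 * u t ^ 2 / ((2 + u t ^ 2) * Real.log (2 + u t ^ 2))) ≤ 1 := by
      rw [← mul_div_assoc, div_le_one (by positivity)]
      nlinarith [hL t ht, sq_nonneg (u t)]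
    linarith
  have hg : ∀ t ∈ Ico t₁ 0, 0 ≤ u t ^ p / Real.log (2 + u t ^ 2) ^ a * u' t := fun t ht =>
    mul_nonneg (div_nonneg (Real.rpow_nonneg (hpos t ht).le _)
      (Real.rpow_nonneg (hLpos t ht).le _)) (hmono t ht)
  have hmon : ∀ {g g' : ℝ → ℝ}, (∀ t ∈ Ico t₁ 0, HasDerivAt g (g' t) t) →
      (∀ t ∈ Ico t₁ 0, 0 ≤ g' t) → ∀ t ∈ Ico t₁ 0, g t₁ ≤ g t := by
    intro g g' hg hg' t ht
    have := monotoneOn_of_deriv_nonneg (convex_Ico t₁ (0 : ℝ))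
      (fun x hx => (hg x hx).continuousAt.continuousWithinAt)
      (fun x hx => (hg x (interior_subset hx)).differentiableAt.differentiableWithinAt)
      (fun x hx => by
        rw [(hg x (interior_subset hx)).deriv]; exact hg' x (interior_subset hx))
    exact this ⟨le_rfl, ht₁⟩ ht ht.1
  have m1 := hmon hde hg
  have m2 := hmon (fun t ht => (hdH t ht).sub (hde t ht)) (fun t ht => by
    nlinarith [hg t ht, hfac t ht])
  have m3 := hmon hdH (fun t ht => mul_nonneg (hg t ht) (by linarith [hfac t ht]))
  have ht₁' : t₁ ∈ Ico t₁ 0 := ⟨le_rfl, ht₁⟩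
  have hH1 := hHpos t₁ ht₁'
  refine ⟨|e t₁| / H t₁ + 1, by positivity, fun t ht => ?_⟩
  have h1 := m1 t ht
  have h2 := m2 t ht
  have h3 := m3 t ht
  simp only [Pi.sub_apply] at h2
  have h4 : |e t₁| ≤ |e t₁| / H t₁ * H t := by
    rw [div_mul_eq_mul_div, le_div_iff₀ hH1]
    exact mul_le_mul_of_nonneg_left h3 (abs_nonneg _)
  have := hHpos t ht
  change |e t| ≤ (|e t₁| / H t₁ + 1) * H t
  rw [abs_le]
  constructor <;> nlinarith [neg_abs_le (e t₁), le_abs_self (e t₁)]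

/-- If `g` vanishes at `0⁻` and `|g'| ≤ B` on `[t, 0)`, then `|g t| ≤ B |t|`. -/
lemma abs_le_mul_neg_of_tendsto_zero {g g' : ℝ → ℝ} {t B : ℝ} (ht : t < 0)
    (hd : ∀ x ∈ Ico t 0, HasDerivAt g (g' x) x) (hB : ∀ x ∈ Ico t 0, |g' x| ≤ B)
    (hlim : Tendsto g (nhdsWithin 0 (Iio 0)) (nhds 0)) : |g t| ≤ B * (-t) := by
  have key : ∀ x ∈ Ico t 0, |g x - g t| ≤ B * (x - t) := fun x hx => by
    have := (convex_Ico t (0 : ℝ)).norm_image_sub_le_of_norm_hasDerivWithin_le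
      (fun y hy => (hd y hy).hasDerivWithinAt) hB ⟨le_rfl, ht⟩ hx
    rwa [Real.norm_eq_abs, Real.norm_eq_abs, abs_of_nonneg (sub_nonneg.2 hx.1)] at this
  have h1 : Tendsto (fun x => |g x - g t|) (nhdsWithin 0 (Iio 0)) (nhds |0 - g t|) :=
    (hlim.sub_const _).abs
  have h2 : Tendsto (fun x => B * (x - t)) (nhdsWithin 0 (Iio 0)) (nhds (B * (0 - t))) :=
    ((continuous_const.mul (continuous_id.sub continuous_const)).tendsto 0).mono_left
      nhdsWithin_le_nhds
  have := le_of_tendsto_of_tendsto h1 h2 (by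
    filter_upwards [Ico_mem_nhdsLT ht] with x hx using key x hx)
  simpa using this

/-- A nonnegative number is at least as close to `1` as its square is. -/
lemma abs_sub_one_le_abs_sq_sub_one {y : ℝ} (hy : 0 ≤ y) : |y - 1| ≤ |y ^ 2 - 1| := by
  rw [show y ^ 2 - 1 = (y - 1) * (y + 1) by ring, abs_mul, abs_of_nonneg (by linarith : 0 ≤ y + 1)]
  nlinarith [abs_nonneg (y - 1)]

lemma kappa0_pos {p : ℝ} (hp : 1 < p) : 0 < kappa0 p := by
  have : 0 < p - 1 := by linarith
  unfold kappa0
  positivity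

lemma f_of_pos {p a v : ℝ} (hv : 0 < v) : f p a v = v ^ p / Real.log (2 + v ^ 2) ^ a := by
  rw [f, abs_of_pos hv, Real.rpow_sub_one hv.ne', div_mul_cancel₀ _ hv.ne']

/-- A solution with the blow-up rate `(-t)^(-2/(p-1))` has `log(2+u^2)` of order `-log(-t)`. -/
lemma le_log_two_add_sq {α b u t : ℝ} (hα : 0 < α) (hb : 0 < b) (ht : t < 0) (hu : 0 < u)
    (h : b < (-t) ^ α * u) (hs : -2 * Real.log b / α ≤ -Real.log (-t)) :
    α * -Real.log (-t) ≤ Real.log (2 + u ^ 2) := by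
  have ht' : 0 < -t := by linarith
  have h1 := Real.log_lt_log hb h
  rw [Real.log_mul (Real.rpow_pos_of_pos ht' _).ne' hu.ne', Real.log_rpow ht'] at h1
  have h2 : Real.log (u ^ 2) ≤ Real.log (2 + u ^ 2) :=
    Real.log_le_log (by positivity) (by linarith)
  rw [Real.log_pow] at h2
  rw [div_le_iff₀ hα] at hs
  push_cast at h2
  linarith

/-- for the similarity-variables solution `φ(s) = e^{-2s/(p-1)} φ₀(-e^{-s})`
coming from a nondecreasing positive blow-up solution `φ₀` of `φ₀'' = φ₀^p + f(φ₀)`,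
the derivative satisfies `|φ'(s)| ≤ C / s^a` for `s` large. -/
theorem stmt_6 (p a t₀ : ℝ) (hp : 1 < p) (ha : 1 < a) (ht₀ : 0 < t₀)
    (φ₀ φ₀' φ₀'' : ℝ → ℝ)
    (hC : ContinuousOn φ₀'' (Set.Ico (-t₀) 0))
    (hd1 : ∀ t ∈ Set.Ico (-t₀) (0:ℝ), HasDerivWithinAt φ₀ (φ₀' t) (Set.Ico (-t₀) 0) t)
    (hd2 : ∀ t ∈ Set.Ico (-t₀) (0:ℝ), HasDerivWithinAt φ₀' (φ₀'' t) (Set.Ico (-t₀) 0) t)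
    (hpos : ∀ t ∈ Set.Ico (-t₀) (0:ℝ), 0 < φ₀ t)
    (hode : ∀ t ∈ Set.Ico (-t₀) (0:ℝ), φ₀'' t = φ₀ t ^ p + f p a (φ₀ t))
    (hmono : ∀ t ∈ Set.Ico (-t₀) (0:ℝ), 0 ≤ φ₀' t)
    (hlim : Filter.Tendsto (fun t => (-t) ^ (2 / (p - 1)) * φ₀ t)
      (nhdsWithin 0 (Set.Iio 0)) (nhds (kappa0 p)))
    (φ : ℝ → ℝ)
    (hφ : ∀ s, φ s = Real.exp (-2 * s / (p - 1)) * φ₀ (-Real.exp (-s))) :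
    ∃ C : ℝ, 0 < C ∧ ∃ s₁ : ℝ, 0 < s₁ ∧ ∀ s : ℝ, s₁ ≤ s → |deriv φ s| ≤ C / s ^ a := by
  have hp1 : 0 < p - 1 := by linarith
  set α := 2 / (p - 1) with hα
  have hαpos : 0 < α := by positivity
  have hκ := kappa0_pos hp
  set κ := kappa0 p
  have hlog : Tendsto (fun t : ℝ => -Real.log (-t)) (nhdsWithin 0 (Iio 0)) atTop := by
    have : Tendsto (fun t : ℝ => -t) (nhdsWithin 0 (Iio 0)) (nhdsWithin 0 (Ioi 0)) := by
      simpa using tendsto_neg_nhdsLT (a := (0 : ℝ))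
    exact tendsto_neg_atBot_atTop.comp (Real.tendsto_log_nhdsGT_zero.comp this)
  have hev : ∀ᶠ t in nhdsWithin (0 : ℝ) (Iio 0),
      (-t₀ < t ∧ t < 0) ∧ κ / 2 < (-t) ^ α * φ₀ t ∧ (-t) ^ α * φ₀ t < 2 * κ ∧
      -2 * Real.log (κ / 2) / α ≤ -Real.log (-t) ∧ 2 * a / α ≤ -Real.log (-t) := by
    filter_upwards [Ioo_mem_nhdsLT (neg_lt_zero.2 ht₀),
      hlim.eventually (lt_mem_nhds (half_lt_self hκ)),
      hlim.eventually (gt_mem_nhds (by linarith : κ < 2 * κ)),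
      hlog.eventually_ge_atTop (-2 * Real.log (κ / 2) / α),
      hlog.eventually_ge_atTop (2 * a / α)] with t h1 h2 h3 h4 h5
    exact ⟨h1, h2, h3, h4, h5⟩
  obtain ⟨t₂, ht₂, hsub⟩ := (mem_nhdsLT_iff_exists_Ioo_subset' (neg_lt_zero.2 ht₀)).1 hev
  obtain ⟨t₁, ht₂₁, ht₁⟩ := exists_between (mem_Iio.1 ht₂)
  have hall : ∀ t ∈ Ico t₁ 0, (-t₀ < t ∧ t < 0) ∧ κ / 2 < (-t) ^ α * φ₀ t ∧
      (-t) ^ α * φ₀ t < 2 * κ ∧ -2 * Real.log (κ / 2) / α ≤ -Real.log (-t) ∧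
      2 * a / α ≤ -Real.log (-t) := fun t ht => hsub ⟨ht₂₁.trans_le ht.1, ht.2⟩
  have hmem : ∀ t ∈ Ico t₁ 0, t ∈ Ico (-t₀) 0 := fun t ht => ⟨(hall t ht).1.1.le, ht.2⟩
  have hnhds : ∀ t ∈ Ico t₁ 0, Ico (-t₀) 0 ∈ nhds t := fun t ht =>
    Ico_mem_nhds (hall t ht).1.1 ht.2
  have hspos : ∀ t ∈ Ico t₁ 0, 0 < -Real.log (-t) := fun t ht =>
    lt_of_lt_of_le (by positivity) (hall t ht).2.2.2.2
  have hu : ∀ t ∈ Ico t₁ 0, 0 < φ₀ t := fun t ht => hpos t (hmem t ht)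
  have hdu : ∀ t ∈ Ico t₁ 0, HasDerivAt φ₀ (φ₀' t) t := fun t ht =>
    (hd1 t (hmem t ht)).hasDerivAt (hnhds t ht)
  have hLα : ∀ t ∈ Ico t₁ 0, α * -Real.log (-t) ≤ Real.log (2 + φ₀ t ^ 2) := fun t ht =>
    le_log_two_add_sq hαpos (half_pos hκ) ht.2 (hu t ht) (hall t ht).2.1 (hall t ht).2.2.2.1
  obtain ⟨K, hK, hE⟩ := exists_abs_energy_le hp ha ht₁ hdu
    (fun t ht => by
      rw [← f_of_pos (hu t ht), ← hode t (hmem t ht)]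
      exact (hd2 t (hmem t ht)).hasDerivAt (hnhds t ht))
    hu (fun t ht => hmono t (hmem t ht))
    (fun t ht => by
      have := (hall t ht).2.2.2.2
      rw [div_le_iff₀ hαpos] at this
      linarith [hLα t ht])
  set k := Real.sqrt (2 / (p + 1)) with hk
  have hkpos : 0 < k := Real.sqrt_pos.2 (by positivity)
  have hk2 : k ^ 2 = 2 / (p + 1) := Real.sq_sqrt (by positivity)
  set y : ℝ → ℝ := fun t => φ₀' t / (k * φ₀ t ^ ((p + 1) / 2)) with hy
  set M := K * (p + 1) / α ^ a with hM
  have hMpos : 0 < M := by positivity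
  have hy1 : ∀ t ∈ Ico t₁ 0, |y t - 1| ≤ M / (-Real.log (-t)) ^ a := fun t ht => by
    have hut := hu t ht
    have hsp := hspos t ht
    have hpow : (φ₀ t ^ ((p + 1) / 2)) ^ 2 = φ₀ t ^ (p + 1) := by
      rw [← Real.rpow_natCast, ← Real.rpow_mul hut.le]; congr 1; push_cast; ring
    have hUpos := Real.rpow_pos_of_pos hut (p + 1)
    have hy0 : 0 ≤ y t := div_nonneg (hmono t (hmem t ht)) (by positivity)
    have hsq : y t ^ 2 - 1 =
        (φ₀' t ^ 2 / 2 - φ₀ t ^ (p + 1) / (p + 1)) * ((p + 1) / φ₀ t ^ (p + 1)) := by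
      simp only [hy, div_pow, mul_pow, hpow, hk2]
      field_simp
    have hLpos : 0 < Real.log (2 + φ₀ t ^ 2) := lt_of_lt_of_le (by positivity) (hLα t ht)
    calc |y t - 1| ≤ |y t ^ 2 - 1| := abs_sub_one_le_abs_sq_sub_one hy0
      _ = |φ₀' t ^ 2 / 2 - φ₀ t ^ (p + 1) / (p + 1)| * ((p + 1) / φ₀ t ^ (p + 1)) := by
        rw [hsq, abs_mul, abs_of_pos (a := (p + 1) / _) (by positivity)]
      _ ≤ K * (φ₀ t ^ (p + 1) / Real.log (2 + φ₀ t ^ 2) ^ a) * ((p + 1) / φ₀ t ^ (p + 1)) := by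
        gcongr
        exact hE t ht
      _ = K * (p + 1) / Real.log (2 + φ₀ t ^ 2) ^ a := by field_simp
      _ ≤ K * (p + 1) / (α * -Real.log (-t)) ^ a := by
        gcongr
        exact hLα t ht
      _ = M / (-Real.log (-t)) ^ a := by
        rw [Real.mul_rpow hαpos.le hsp.le, hM, div_div]
  set c := (p - 1) / 2 * k with hc
  have hcpos : 0 < c := by positivity
  set w : ℝ → ℝ := fun t => φ₀ t ^ (-((p - 1) / 2)) with hw
  have hdw : ∀ t ∈ Ico t₁ 0, HasDerivAt w (-(c * y t)) t := fun t ht => by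
    have hut := hu t ht
    refine ((hdu t ht).rpow_const (Or.inl hut.ne')).congr_deriv ?_
    rw [show -((p - 1) / 2) - 1 = -((p + 1) / 2) by ring, Real.rpow_neg hut.le]
    have := Real.rpow_pos_of_pos hut ((p + 1) / 2)
    simp only [hy, hc]
    field_simp
  have hweq : ∀ t ∈ Ico t₁ 0, w t = ((-t) ^ α * φ₀ t) ^ (-((p - 1) / 2)) * (-t) := fun t ht => by
    have ht' : 0 < -t := by linarith [ht.2]
    rw [Real.mul_rpow (Real.rpow_nonneg ht'.le _) (hu t ht).le, ← Real.rpow_mul ht'.le,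
      show α * -((p - 1) / 2) = -1 by rw [hα]; field_simp, Real.rpow_neg_one,
      mul_right_comm, inv_mul_cancel₀ ht'.ne', one_mul]
  have hw0 : Tendsto w (nhdsWithin 0 (Iio 0)) (nhds 0) := by
    have h1 : Tendsto (fun t => ((-t) ^ α * φ₀ t) ^ (-((p - 1) / 2)) * (-t))
        (nhdsWithin 0 (Iio 0)) (nhds (κ ^ (-((p - 1) / 2)) * (-0))) :=
      (hlim.rpow_const (Or.inl hκ.ne')).mul
        ((continuous_neg.tendsto (0 : ℝ)).mono_left nhdsWithin_le_nhds)
    rw [neg_zero, mul_zero] at h1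
    refine h1.congr' ?_
    filter_upwards [Ico_mem_nhdsLT ht₁] with t ht using (hweq t ht).symm
  have hwc : ∀ t ∈ Ico t₁ 0, |w t - c * (-t)| ≤ c * (M / (-Real.log (-t)) ^ a) * (-t) :=
    fun t ht => by
    have hsub' : ∀ x ∈ Ico t 0, x ∈ Ico t₁ 0 := fun x hx => ⟨ht.1.trans hx.1, hx.2⟩
    refine abs_le_mul_neg_of_tendsto_zero (g := fun x => w x - c * (-x))
      (g' := fun x => -(c * y x) - c * (-1)) ht.2
      (fun x hx => (hdw x (hsub' x hx)).sub ((hasDerivAt_neg x).const_mul c))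
      (fun x hx => ?_) ?_
    · rw [show -(c * y x) - c * (-1) = -(c * (y x - 1)) by ring, abs_neg, abs_mul,
        abs_of_pos hcpos]
      have hx0 : 0 < -x := by linarith [hx.2]
      have hst := hspos t ht
      have : -Real.log (-t) ≤ -Real.log (-x) :=
        neg_le_neg (Real.log_le_log hx0 (by linarith [hx.1]))
      refine mul_le_mul_of_nonneg_left ((hy1 x (hsub' x hx)).trans ?_) hcpos.le
      gcongr
    · have : Tendsto (fun x : ℝ => c * (-x)) (nhdsWithin 0 (Iio 0)) (nhds (c * (-0))) :=
        ((continuous_const.mul continuous_neg).tendsto (0 : ℝ)).mono_left nhdsWithin_le_nhds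
      simpa using hw0.sub this
  set b := (2 * κ) ^ (-((p - 1) / 2)) with hb
  have hbpos : 0 < b := by positivity
  have hwlow : ∀ t ∈ Ico t₁ 0, b * (-t) ≤ w t := fun t ht => by
    have ht' : 0 < -t := by linarith [ht.2]
    rw [hweq t ht]
    refine mul_le_mul_of_nonneg_right ?_ ht'.le
    exact Real.rpow_le_rpow_of_nonpos (mul_pos (Real.rpow_pos_of_pos ht' _) (hu t ht))
      (hall t ht).2.2.1.le (by linarith)
  refine ⟨α * (2 * κ) * (2 * c * M / b), by positivity, max 1 (-Real.log (-t₁)),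
    by positivity, fun s hs => ?_⟩
  have hs1 : -Real.log (-t₁) ≤ s := (le_max_right _ _).trans hs
  set t := -Real.exp (-s) with ht
  have hts : -t = Real.exp (-s) := by rw [ht, neg_neg]
  have htpos : 0 < -t := hts ▸ Real.exp_pos _
  have hsl : -Real.log (-t) = s := by rw [hts, Real.log_exp, neg_neg]
  have htm : t ∈ Ico t₁ 0 := by
    refine ⟨?_, by linarith⟩
    have : Real.exp (-s) ≤ -t₁ := by
      rw [← Real.le_log_iff_exp_le (by linarith)]; linarith
    linarith
  have hs0 : 0 < s := hsl ▸ hspos t htm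
  have hτ : Real.exp (-2 * s / (p - 1)) = (-t) ^ α := by
    rw [hts, ← Real.exp_mul]; congr 1; rw [hα]; field_simp
  have hut := hu t htm
  have hderiv : HasDerivAt φ (α * ((-t) ^ α * φ₀ t) * ((c * y t * (-t) - w t) / w t)) s := by
    rw [show φ = fun s => Real.exp (-2 * s / (p - 1)) * φ₀ (-Real.exp (-s)) from funext hφ]
    have h1 : HasDerivAt (fun s : ℝ => Real.exp (-2 * s / (p - 1)))
        (Real.exp (-2 * s / (p - 1)) * (-2 * 1 / (p - 1))) s :=
      (((hasDerivAt_id s).const_mul (-2)).div_const (p - 1)).exp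
    have h2 : HasDerivAt (fun s : ℝ => -Real.exp (-s)) (-(Real.exp (-s) * -1)) s :=
      ((hasDerivAt_neg s).exp).neg
    have h3 : HasDerivAt (fun s : ℝ => φ₀ (-Real.exp (-s)))
        (φ₀' t * -(Real.exp (-s) * -1)) s := (hdu t htm).comp s h2
    refine (h1.mul h3).congr_deriv ?_
    rw [← ht, hτ, ← hts]
    have e1 : c * y t = (p - 1) / 2 * φ₀' t / φ₀ t * w t := by
      simp only [hc, hy, hw]
      rw [show -((p - 1) / 2) = 1 - (p + 1) / 2 by ring, Real.rpow_sub hut, Real.rpow_one]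
      have := Real.rpow_pos_of_pos hut ((p + 1) / 2)
      field_simp
    have hwt : 0 < w t := Real.rpow_pos_of_pos hut _
    rw [e1, hα]
    field_simp
    ring
  rw [hderiv.deriv]
  have hb1 := hwlow t htm
  have hwt : 0 < w t := lt_of_lt_of_le (by positivity) hb1
  have hy2 := hy1 t htm
  have hw2 := hwc t htm
  rw [hsl] at hy2 hw2
  have hnum : |c * y t * (-t) - w t| ≤ 2 * c * M / s ^ a * (-t) := by
    have e2 : c * y t * (-t) - w t = c * (-t) * (y t - 1) - (w t - c * (-t)) := by ring
    have e3 : |c * (-t) * (y t - 1)| ≤ c * (-t) * (M / s ^ a) := by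
      rw [abs_mul, abs_of_pos (mul_pos hcpos htpos)]
      exact mul_le_mul_of_nonneg_left hy2 (mul_pos hcpos htpos).le
    rw [e2]
    calc _ ≤ _ := abs_sub _ _
      _ ≤ c * (-t) * (M / s ^ a) + c * (M / s ^ a) * (-t) := add_le_add e3 hw2
      _ = _ := by ring
  have hφpos : 0 < (-t) ^ α * φ₀ t := mul_pos (Real.rpow_pos_of_pos htpos _) hut
  have hquot : |(c * y t * (-t) - w t) / w t| ≤ 2 * c * M / b / s ^ a := by
    rw [abs_div, abs_of_pos hwt]
    calc _ ≤ (2 * c * M / s ^ a * (-t)) / (b * (-t)) := by gcongr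
      _ = _ := by rw [mul_div_mul_right _ _ htpos.ne', div_right_comm]
  rw [abs_mul, abs_of_pos (mul_pos hαpos hφpos), mul_div_assoc]
  have := (hall t htm).2.2.1.le
  gcongr
end

section
/- Let p > 1 and a > 1, and let f(v) = |v|^{p-1} v / (log(2 + v^2))^a. For x ≥ 0, q ∈ ℝ and s ≥ 0 define f̂(x, q, s) = e^{-2ps/(p-1)} · ( f(e^{2s/(p-1)}(x + q)) - f(e^{2s/(p-1)} x) - e^{2s/(p-1)} q · f'(e^{2s/(p-1)} x) ). Then there exists C > 0 such that for all s ≥ 0, all x ≥ 0 and all q ∈ ℝ: |f̂(x, q, s)| ≤ C (δ_{p≥2} · x^{p-2} q² + |q|^p), where δ_{p≥2} equals 1 if p ≥ 2 and 0 if 1 < p < 2. -/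
open Filter Set

/-- The quadratic remainder `f̂` of the linearization of the rescaled perturbation. -/
noncomputable def fhat (p a x q s : ℝ) : ℝ :=
  Real.exp (-2 * p * s / (p - 1)) *
    (f p a (Real.exp (2 * s / (p - 1)) * (x + q))
      - f p a (Real.exp (2 * s / (p - 1)) * x)
      - Real.exp (2 * s / (p - 1)) * q * deriv (f p a) (Real.exp (2 * s / (p - 1)) * x))

lemma log_two_add_sq_pos (v : ℝ) : 0 < Real.log (2 + v ^ 2) :=
  Real.log_pos (by nlinarith [sq_nonneg v])

lemma log_two_add_sq_rpow_neg_le {b : ℝ} (hb : 0 ≤ b) (v : ℝ) :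
    Real.log (2 + v ^ 2) ^ (-b) ≤ Real.log 2 ^ (-b) :=
  Real.rpow_le_rpow_of_nonpos (Real.log_pos (by norm_num))
    (Real.log_le_log (by norm_num) (by nlinarith [sq_nonneg v])) (by linarith)

lemma hasDerivAt_log_two_add_sq_rpow (b v : ℝ) :
    HasDerivAt (fun v : ℝ => Real.log (2 + v ^ 2) ^ b)
      (2 * v / (2 + v ^ 2) * b * Real.log (2 + v ^ 2) ^ (b - 1)) v := by
  have h₁ : HasDerivAt (fun v : ℝ => 2 + v ^ 2) (2 * v) v := by
    simpa using (hasDerivAt_pow 2 v).const_add 2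
  exact (h₁.log (by positivity)).rpow_const (Or.inl (log_two_add_sq_pos v).ne')

lemma hasDerivAt_abs_rpow_mul_self {p : ℝ} (hp : 1 < p) (v : ℝ) :
    HasDerivAt (fun v : ℝ => |v| ^ (p - 1) * v) (p * |v| ^ (p - 1)) v := by
  rcases lt_trichotomy v 0 with hv | rfl | hv
  · have h := ((hasDerivAt_neg v).rpow_const (p := p) (Or.inl (by linarith))).neg
    have h' : HasDerivAt (fun v : ℝ => -(-v) ^ p) (p * |v| ^ (p - 1)) v := by
      refine HasDerivAt.congr_deriv h ?_
      rw [abs_of_neg hv]; ring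
    refine h'.congr_of_eventuallyEq ?_
    filter_upwards [Iio_mem_nhds hv] with y hy
    have hy : y < 0 := hy
    rw [abs_of_neg hy, Real.rpow_sub_one (by linarith)]
    field_simp [hy.ne]
  · rw [hasDerivAt_iff_tendsto_slope]
    have h : Tendsto (fun y : ℝ => |y| ^ (p - 1)) (nhds 0) (nhds (p * |(0 : ℝ)| ^ (p - 1))) := by
      have hc : Continuous fun y : ℝ => |y| ^ (p - 1) :=
        continuous_abs.rpow_const fun _ => Or.inr (by linarith)
      have := hc.tendsto 0
      simpa [Real.zero_rpow (show p - 1 ≠ 0 by linarith)] using this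
    refine (h.mono_left nhdsWithin_le_nhds).congr' ?_
    filter_upwards [self_mem_nhdsWithin] with y hy
    have hy : y ≠ 0 := hy
    simp [slope_def_field, hy]
  · refine (Real.hasDerivAt_rpow_const (p := p) (Or.inl hv.ne')).congr_of_eventuallyEq ?_ |>.congr_deriv
      (by rw [abs_of_pos hv])
    filter_upwards [Ioi_mem_nhds hv] with y hy
    have hy : 0 < y := hy
    rw [abs_of_pos hy, Real.rpow_sub_one hy.ne']
    field_simp

/-- The factor multiplying `|v| ^ (p - 1)` in the derivative of `f p a`. -/
noncomputable def derivFactor (p a v : ℝ) : ℝ :=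
  p * Real.log (2 + v ^ 2) ^ (-a)
    - a * (2 * v ^ 2 / (2 + v ^ 2)) * Real.log (2 + v ^ 2) ^ (-(a + 1))

lemma hasDerivAt_f {p : ℝ} (hp : 1 < p) (a v : ℝ) :
    HasDerivAt (f p a) (|v| ^ (p - 1) * derivFactor p a v) v := by
  have h := (hasDerivAt_abs_rpow_mul_self hp v).mul (hasDerivAt_log_two_add_sq_rpow (-a) v)
  have hf : f p a = (fun v : ℝ => |v| ^ (p - 1) * v) * fun v : ℝ => Real.log (2 + v ^ 2) ^ (-a) := by
    funext v
    simp only [f, Pi.mul_apply, Real.rpow_neg (log_two_add_sq_pos v).le, div_eq_mul_inv]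
  rw [hf]
  refine h.congr_deriv ?_
  rw [derivFactor, show -a - 1 = -(a + 1) by ring]
  ring

lemma hasDerivAt_derivFactor (p a v : ℝ) :
    HasDerivAt (derivFactor p a)
      (-(p * a * (2 * v / (2 + v ^ 2)) * Real.log (2 + v ^ 2) ^ (-(a + 1)))
        - a * (8 * v / (2 + v ^ 2) ^ 2) * Real.log (2 + v ^ 2) ^ (-(a + 1))
        + a * (a + 1) * (2 * v ^ 2 / (2 + v ^ 2)) * (2 * v / (2 + v ^ 2))
          * Real.log (2 + v ^ 2) ^ (-(a + 2))) v := by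
  have hne : 2 + v ^ 2 ≠ 0 := by positivity
  have h₁ : HasDerivAt (fun v : ℝ => 2 * v ^ 2 / (2 + v ^ 2)) (8 * v / (2 + v ^ 2) ^ 2) v := by
    have h₂ := hasDerivAt_pow 2 v
    refine ((h₂.const_mul 2).div (h₂.const_add 2) hne).congr_deriv ?_
    push_cast
    field_simp
    ring
  refine (((hasDerivAt_log_two_add_sq_rpow (-a) v).const_mul p).sub
    ((h₁.const_mul a).mul (hasDerivAt_log_two_add_sq_rpow (-(a + 1)) v))).congr_deriv ?_
  rw [show -a - 1 = -(a + 1) by ring, show -(a + 1) - 1 = -(a + 2) by ring]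
  ring

lemma abs_derivFactor_le {p a : ℝ} (hp : 0 ≤ p) (ha : 0 ≤ a) (v : ℝ) :
    |derivFactor p a v| ≤ p * Real.log 2 ^ (-a) + a * 2 * Real.log 2 ^ (-(a + 1)) := by
  have hL := log_two_add_sq_pos v
  have hr : 2 * v ^ 2 / (2 + v ^ 2) ≤ 2 := by
    rw [div_le_iff₀ (by positivity)]; linarith
  have h₁ := log_two_add_sq_rpow_neg_le ha v
  have h₂ := log_two_add_sq_rpow_neg_le (show 0 ≤ a + 1 by linarith) v
  refine (abs_sub _ _).trans ?_
  rw [abs_of_nonneg (by positivity), abs_of_nonneg (by positivity)]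
  gcongr

lemma abs_mul_deriv_derivFactor_le {p a : ℝ} (hp : 0 ≤ p) (ha : 0 ≤ a) (v : ℝ) :
    |v * deriv (derivFactor p a) v| ≤ p * a * 2 * Real.log 2 ^ (-(a + 1))
      + a * 1 * Real.log 2 ^ (-(a + 1)) + a * (a + 1) * 2 * 2 * Real.log 2 ^ (-(a + 2)) := by
  have hL := log_two_add_sq_pos v
  have hr : 2 * v ^ 2 / (2 + v ^ 2) ≤ 2 := by
    rw [div_le_iff₀ (by positivity)]; linarith
  have hr' : 8 * v ^ 2 / (2 + v ^ 2) ^ 2 ≤ 1 := by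
    rw [div_le_iff₀ (by positivity)]; nlinarith [sq_nonneg (v ^ 2 - 2)]
  have h₁ := log_two_add_sq_rpow_neg_le (show 0 ≤ a + 1 by linarith) v
  have h₂ := log_two_add_sq_rpow_neg_le (show 0 ≤ a + 2 by linarith) v
  rw [(hasDerivAt_derivFactor p a v).deriv]
  have key : ∀ A B C : ℝ, 0 ≤ A → 0 ≤ B → 0 ≤ C → |-A - B + C| ≤ A + B + C := by
    intro A B C _ _ _
    rw [abs_le]; constructor <;> linarith
  have := key (p * a * (2 * v ^ 2 / (2 + v ^ 2)) * Real.log (2 + v ^ 2) ^ (-(a + 1)))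
    (a * (8 * v ^ 2 / (2 + v ^ 2) ^ 2) * Real.log (2 + v ^ 2) ^ (-(a + 1)))
    (a * (a + 1) * (2 * v ^ 2 / (2 + v ^ 2)) * (2 * v ^ 2 / (2 + v ^ 2))
          * Real.log (2 + v ^ 2) ^ (-(a + 2))) (by positivity) (by positivity) (by positivity)
  refine le_trans (le_of_eq ?_) (this.trans ?_)
  · congr 1; ring
  · gcongr

/-- `f' = |v| ^ (p - 1) * derivFactor` has modulus of continuity controlled by `|v| ^ (p - 1)`. -/
lemma exists_abs_deriv_f_sub_le {p a : ℝ} (hp : 1 < p) (ha : 0 ≤ a) :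
    ∃ M : ℝ, 0 < M ∧ ∀ u v : ℝ,
      |deriv (f p a) u - deriv (f p a) v| ≤ M * |(|u| ^ (p - 1) - |v| ^ (p - 1))| := by
  set A := p * Real.log 2 ^ (-a) + a * 2 * Real.log 2 ^ (-(a + 1))
  set B := p * a * 2 * Real.log 2 ^ (-(a + 1))
      + a * 1 * Real.log 2 ^ (-(a + 1)) + a * (a + 1) * 2 * 2 * Real.log 2 ^ (-(a + 2))
  have hlog : 0 < Real.log 2 := Real.log_pos (by norm_num)
  have hA : 0 < A := by positivity
  have hB : 0 ≤ B := by positivity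
  have hp1 : 0 < p - 1 := by linarith
  let G : ℝ → ℝ := fun v => v ^ (p - 1) * derivFactor p a v
  have hG : ∀ v, deriv (f p a) v = G |v| := fun v => by
    simp [G, (hasDerivAt_f hp a v).deriv, derivFactor]
  set M := A + B / (p - 1) with hM
  have hpow : Continuous fun v : ℝ => v ^ (p - 1) := Real.continuous_rpow_const hp1.le
  have hGc : Continuous G :=
    hpow.mul <| continuous_iff_continuousAt.2 fun v => (hasDerivAt_derivFactor p a v).continuousAt
  have hderiv : ∀ v, 0 < v → ∃ d, HasDerivAt G d v ∧ |d| ≤ M * ((p - 1) * v ^ (p - 1 - 1)) := by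
    intro v hv
    refine ⟨_, (Real.hasDerivAt_rpow_const (p := p - 1) (Or.inl hv.ne')).mul
      (hasDerivAt_derivFactor p a v), ?_⟩
    rw [← (hasDerivAt_derivFactor p a v).deriv]
    have h₁ := abs_derivFactor_le (show 0 ≤ p by linarith) ha v
    have h₂ := abs_mul_deriv_derivFactor_le (show 0 ≤ p by linarith) ha v
    have hv' : v ^ (p - 1) = v ^ (p - 1 - 1) * v := by
      rw [Real.rpow_sub_one hv.ne' (p - 1)]; field_simp
    have hpos : 0 < v ^ (p - 1 - 1) := by positivity
    calc _ = v ^ (p - 1 - 1) *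
          |(p - 1) * derivFactor p a v + v * deriv (derivFactor p a) v| := by
            rw [← abs_of_pos hpos, ← abs_mul, abs_of_pos hpos, hv']
            congr 1; ring
      _ ≤ v ^ (p - 1 - 1) * ((p - 1) * A + B) := by
            gcongr
            refine (abs_add_le _ _).trans (add_le_add ?_ h₂)
            rw [abs_mul, abs_of_pos hp1]
            gcongr
      _ = _ := by rw [hM]; field_simp
  have mono : ∀ ε : ℝ, |ε| = 1 → MonotoneOn (fun v => M * v ^ (p - 1) + ε * G v) (Ici 0) := by
    intro ε hε
    refine monotoneOn_of_deriv_nonneg (convex_Ici 0) (by fun_prop) ?_ ?_ <;>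
      simp only [interior_Ici]
    · intro v hv
      obtain ⟨d, hd, -⟩ := hderiv v hv
      exact (((Real.hasDerivAt_rpow_const (Or.inl (ne_of_gt hv))).const_mul M).add
        (hd.const_mul ε)).differentiableAt.differentiableWithinAt
    · intro v hv
      obtain ⟨d, hd, hle⟩ := hderiv v hv
      have h := ((Real.hasDerivAt_rpow_const (p := p - 1) (Or.inl (ne_of_gt hv))).const_mul M).add
        (hd.const_mul ε)
      have h' : deriv (fun v => M * v ^ (p - 1) + ε * G v) v = _ := h.deriv
      rw [h']
      have : |ε * d| ≤ M * ((p - 1) * v ^ (p - 1 - 1)) := by rwa [abs_mul, hε, one_mul]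
      linarith [neg_abs_le (ε * d)]
  have main : ∀ u v : ℝ, 0 ≤ u → u ≤ v → |G u - G v| ≤ M * |u ^ (p - 1) - v ^ (p - 1)| := by
    intro u v hu huv
    have h₁ := mono 1 (by simp) hu (hu.trans huv : (0 : ℝ) ≤ v) huv
    have h₂ := mono (-1) (by simp) hu (hu.trans huv : (0 : ℝ) ≤ v) huv
    have h₃ : u ^ (p - 1) ≤ v ^ (p - 1) := Real.rpow_le_rpow hu huv hp1.le
    rw [abs_of_nonpos (sub_nonpos.2 h₃), abs_le]
    constructor <;> simp only at h₁ h₂ <;> linarith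
  refine ⟨M, by positivity, fun u v => ?_⟩
  rw [hG, hG]
  rcases le_total |u| |v| with h | h
  · exact main _ _ (abs_nonneg _) h
  · rw [abs_sub_comm, abs_sub_comm (|u| ^ (p - 1))]
    exact main _ _ (abs_nonneg _) h

/-- Subadditivity of `t ↦ t ^ r` for `0 ≤ r ≤ 1`, as a Hölder estimate. -/
lemma abs_abs_rpow_sub_abs_rpow_le {r : ℝ} (hr : 0 ≤ r) (hr1 : r ≤ 1) (u v : ℝ) :
    |(|u| ^ r - |v| ^ r)| ≤ |u - v| ^ r := by
  have key : ∀ u v : ℝ, |u| ^ r - |v| ^ r ≤ |u - v| ^ r := by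
    intro u v
    have h₁ : |u| ≤ |u - v| + |v| := by simpa using abs_add_le (u - v) v
    have h₂ := Real.rpow_le_rpow (abs_nonneg u) h₁ hr
    have h₃ := Real.rpow_add_le_add_rpow (abs_nonneg (u - v)) (abs_nonneg v) hr hr1
    linarith
  rw [abs_le]
  have := key v u
  rw [abs_sub_comm] at this
  exact ⟨by linarith, key u v⟩

/-- Mean value estimate for `t ↦ t ^ r` with `1 ≤ r`. -/
lemma abs_abs_rpow_sub_abs_rpow_le_of_le {r R u v : ℝ} (hr : 1 ≤ r) (hu : |u| ≤ R) (hv : |v| ≤ R) :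
    |(|u| ^ r - |v| ^ r)| ≤ r * R ^ (r - 1) * |u - v| := by
  have h := (convex_Icc (0 : ℝ) R).norm_image_sub_le_of_norm_hasDerivWithin_le
    (f := fun t : ℝ => t ^ r) (f' := fun t => r * t ^ (r - 1)) (C := r * R ^ (r - 1))
    (fun t _ => (Real.hasDerivAt_rpow_const (Or.inr hr)).hasDerivWithinAt)
    (fun t ht => by
      have := ht.1
      rw [Real.norm_of_nonneg (by positivity)]
      gcongr
      exact ht.2)
    ⟨abs_nonneg v, hv⟩ ⟨abs_nonneg u, hu⟩
  have hR : 0 ≤ R := (abs_nonneg u).trans hu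
  simp only [Real.norm_eq_abs] at h
  refine h.trans ?_
  exact mul_le_mul_of_nonneg_left (abs_abs_sub_abs_le u v) (by positivity)

lemma add_rpow_le_two_rpow_mul {x y r : ℝ} (hx : 0 ≤ x) (hy : 0 ≤ y) (hr : 0 ≤ r) :
    (x + y) ^ r ≤ 2 ^ r * (x ^ r + y ^ r) := by
  have hx' := Real.rpow_nonneg hx r
  have hy' := Real.rpow_nonneg hy r
  rcases le_total x y with h | h
  · calc (x + y) ^ r ≤ (2 * y) ^ r := by gcongr; linarith
      _ = 2 ^ r * y ^ r := Real.mul_rpow (by norm_num) hy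
      _ ≤ _ := by gcongr; linarith
  · calc (x + y) ^ r ≤ (2 * x) ^ r := by gcongr; linarith
      _ = 2 ^ r * x ^ r := Real.mul_rpow (by norm_num) hx
      _ ≤ _ := by gcongr; linarith

lemma abs_taylor_remainder_le {F : ℝ → ℝ} (hF : Differentiable ℝ F) {x q K : ℝ}
    (h : ∀ v, |v - x| ≤ |q| → |deriv F v - deriv F x| ≤ K) :
    |F (x + q) - F x - q * deriv F x| ≤ K * |q| := by
  have := (convex_closedBall x |q|).norm_image_sub_le_of_norm_hasDerivWithin_le
    (f := fun v => F v - v * deriv F x) (f' := fun v => deriv F v - deriv F x) (C := K)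
    (x := x) (y := x + q)
    (fun v _ => by
      have h' := (hF v).hasDerivAt.sub ((hasDerivAt_id v).mul_const (deriv F x))
      rw [one_mul] at h'
      exact h'.hasDerivWithinAt)
    (fun v hv => h v (by simpa [Real.dist_eq] using hv))
    (by simp) (by simp)
  simp only [Real.norm_eq_abs, add_sub_cancel_left] at this
  refine le_trans (le_of_eq ?_) this
  congr 1; ring

lemma exists_abs_f_remainder_le {p a : ℝ} (hp : 1 < p) (ha : 0 ≤ a) :
    ∃ C : ℝ, 0 < C ∧ ∀ x : ℝ, 0 ≤ x → ∀ q : ℝ,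
      |f p a (x + q) - f p a x - q * deriv (f p a) x| ≤
        C * ((if 2 ≤ p then (1:ℝ) else 0) * x ^ (p - 2) * q ^ 2 + |q| ^ p) := by
  obtain ⟨M, hM, hmod⟩ := exists_abs_deriv_f_sub_le hp ha
  have hF : Differentiable ℝ (f p a) := fun v => (hasDerivAt_f hp a v).differentiableAt
  have hsplit : ∀ q : ℝ, |q| ^ (p - 1) * |q| = |q| ^ p := fun q => by
    conv_rhs => rw [show p = (p - 1) + 1 by ring]
    rw [Real.rpow_add_one' (abs_nonneg q) (by linarith)]
  split_ifs with h2
  · refine ⟨M * ((p - 1) * 2 ^ (p - 2)), ?_, fun x hx q => ?_⟩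
    · have : 0 < p - 1 := by linarith
      positivity
    have h := abs_taylor_remainder_le hF (x := x) (q := q)
      (K := M * ((p - 1) * (2 ^ (p - 2) * (x ^ (p - 2) + |q| ^ (p - 2))) * |q|)) fun v hv => by
        refine (hmod v x).trans (mul_le_mul_of_nonneg_left ?_ hM.le)
        have hvx : |v| ≤ x + |q| := by
          have := abs_add_le (v - x) x
          rw [sub_add_cancel, abs_of_nonneg hx] at this
          linarith
        refine (abs_abs_rpow_sub_abs_rpow_le_of_le (R := x + |q|) (by linarith) hvx
          (by rw [abs_of_nonneg hx]; linarith [abs_nonneg q])).trans ?_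
        have h₁ := add_rpow_le_two_rpow_mul hx (abs_nonneg q) (show 0 ≤ p - 2 by linarith)
        rw [show p - 1 - 1 = p - 2 by ring]
        have : 0 ≤ p - 1 := by linarith
        gcongr
    refine h.trans (le_of_eq ?_)
    have h₁ : |q| ^ (p - 2) * |q| = |q| ^ (p - 1) := by
      conv_rhs => rw [show p - 1 = (p - 2) + 1 by ring]
      rw [Real.rpow_add_one' (abs_nonneg q) (by linarith)]
    rw [← hsplit q, ← h₁, ← sq_abs q]
    ring
  · refine ⟨M, hM, fun x hx q => ?_⟩
    have h := abs_taylor_remainder_le hF (x := x) (q := q) (K := M * |q| ^ (p - 1)) fun v hv => by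
      refine (hmod v x).trans (mul_le_mul_of_nonneg_left ?_ hM.le)
      exact (abs_abs_rpow_sub_abs_rpow_le (by linarith) (by linarith) v x).trans
        (Real.rpow_le_rpow (abs_nonneg _) hv (by linarith))
    rw [mul_assoc, hsplit] at h
    simpa using h

/-- `|f̂(x,q,s)| ≤ C (δ_{p≥2} x^{p-2} q² + |q|^p)`, uniformly in `s ≥ 0`. -/
theorem stmt_10 (p a : ℝ) (hp : 1 < p) (ha : 1 < a) :
    ∃ C : ℝ, 0 < C ∧ ∀ s : ℝ, 0 ≤ s → ∀ x : ℝ, 0 ≤ x → ∀ q : ℝ,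
      |fhat p a x q s| ≤
        C * ((if 2 ≤ p then (1:ℝ) else 0) * x ^ (p - 2) * q ^ 2 + |q| ^ p) := by
  obtain ⟨C, hC, h⟩ := exists_abs_f_remainder_le hp (show 0 ≤ a by linarith)
  refine ⟨C, hC, fun s _ x hx q => ?_⟩
  set l := Real.exp (2 * s / (p - 1)) with hl
  have hl0 : 0 < l := Real.exp_pos _
  have hexp : Real.exp (-2 * p * s / (p - 1)) = (l ^ p)⁻¹ := by
    rw [hl, ← Real.exp_mul, ← Real.exp_neg]
    congr 1; ring
  have hlp : 0 < l ^ p := by positivity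
  have hpow : l ^ (p - 2) * l ^ 2 = l ^ p := by
    rw [← Real.rpow_natCast l 2, ← Real.rpow_add hl0]
    norm_num
  have hlx := h (l * x) (by positivity) (l * q)
  rw [← mul_add, Real.mul_rpow hl0.le hx, abs_mul, abs_of_pos hl0,
    Real.mul_rpow hl0.le (abs_nonneg q), mul_pow] at hlx
  rw [fhat, ← hl, hexp, abs_mul, abs_of_pos (inv_pos.2 hlp), inv_mul_le_iff₀ hlp]
  refine hlx.trans (le_of_eq ?_)
  rw [← hpow]
  ring
end
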